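/- arXiv:1703.08852 — 2 statements merged into one kernel-verified Lean document; each statement's English description precedes it below -/
import Mathlib

section
/- Let p, q > 0. For all x₁, y₁, x₂, y₂ > 0, the extended (p,q)-beta function satisfies B_{p,q}((x₁+x₂)/2, (y₁+y₂)/2)² ≤ B_{p,q}(x₁, y₁) · B_{p,q}(x₂, y₂). -/
/-- The extended `(p,q)`-beta function
`B_{p,q}(x,y) = ∫₀¹ t^(x-1) (1-t)^(y-1) exp(-p/t - q/(1-t)) dt`. -/
noncomputable def extBeta (p q x y : ℝ) : ℝ :=
  ∫ t in (0:ℝ)..1, t ^ (x - 1) * (1 - t) ^ (y - 1) * Real.exp (-p / t - q / (1 - t))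

open MeasureTheory Set

/-- The Cauchy–Schwarz inequality for square roots of nonnegative integrable functions. -/
theorem sq_integral_sqrt_mul_sqrt_le {α : Type*} [MeasurableSpace α] {μ : Measure α}
    {f g : α → ℝ} (hf : Integrable f μ) (hg : Integrable g μ)
    (hf₀ : 0 ≤ᵐ[μ] f) (hg₀ : 0 ≤ᵐ[μ] g) :
    (∫ a, √(f a) * √(g a) ∂μ) ^ 2 ≤ (∫ a, f a ∂μ) * ∫ a, g a ∂μ := by
  have sq_sqrt_ae {h : α → ℝ} (h₀ : 0 ≤ᵐ[μ] h) : (fun a ↦ √(h a) ^ 2) =ᵐ[μ] h := by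
    filter_upwards [h₀] with a ha using Real.sq_sqrt ha
  have memLp_sqrt {h : α → ℝ} (hh : Integrable h μ) (h₀ : 0 ≤ᵐ[μ] h) :
      MemLp (fun a ↦ √(h a)) (ENNReal.ofReal 2) μ := by
    rw [ENNReal.ofReal_ofNat, memLp_two_iff_integrable_sq
      (Real.continuous_sqrt.comp_aestronglyMeasurable hh.aestronglyMeasurable)]
    exact hh.congr (sq_sqrt_ae h₀).symm
  have holder := integral_mul_le_Lp_mul_Lq_of_nonneg Real.HolderConjugate.two_two
    (.of_forall fun a ↦ Real.sqrt_nonneg (f a)) (.of_forall fun a ↦ Real.sqrt_nonneg (g a))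
    (memLp_sqrt hf hf₀) (memLp_sqrt hg hg₀)
  simp only [Real.rpow_two, ← Real.sqrt_eq_rpow] at holder
  rw [integral_congr_ae (sq_sqrt_ae hf₀), integral_congr_ae (sq_sqrt_ae hg₀)] at holder
  calc (∫ a, √(f a) * √(g a) ∂μ) ^ 2
      ≤ (√(∫ a, f a ∂μ) * √(∫ a, g a ∂μ)) ^ 2 :=
        pow_le_pow_left₀ (integral_nonneg fun a ↦ by positivity) holder 2
    _ = (∫ a, f a ∂μ) * ∫ a, g a ∂μ := by
        rw [mul_pow, Real.sq_sqrt (integral_nonneg_of_ae hf₀),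
          Real.sq_sqrt (integral_nonneg_of_ae hg₀)]

theorem integrableOn_extBeta_integrand {p q x y : ℝ} (hp : 0 ≤ p) (hq : 0 ≤ q)
    (hx : 0 < x) (hy : 0 < y) :
    IntegrableOn (fun t : ℝ ↦ t ^ (x - 1) * (1 - t) ^ (y - 1) * Real.exp (-p / t - q / (1 - t)))
      (Ioo 0 1) := by
  have beta : IntegrableOn
      (fun t : ℝ ↦ (t : ℂ) ^ ((x : ℂ) - 1) * (1 - (t : ℂ)) ^ ((y : ℂ) - 1)) (Ioo 0 1) :=
    (intervalIntegrable_iff_integrableOn_Ioo_of_le zero_le_one).1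
      (Complex.betaIntegral_convergent (by simpa) (by simpa))
  refine Integrable.mono beta (by fun_prop) ?_
  filter_upwards [ae_restrict_mem measurableSet_Ioo] with t ⟨ht₀, ht₁⟩
  have hs : 0 < 1 - t := sub_pos.2 ht₁
  have hexp : Real.exp (-p / t - q / (1 - t)) ≤ 1 := by
    rw [Real.exp_le_one_iff, neg_div]
    have : 0 ≤ p / t := by positivity
    have : 0 ≤ q / (1 - t) := by positivity
    linarith
  have hnorm : ‖(t : ℂ) ^ ((x : ℂ) - 1) * (1 - (t : ℂ)) ^ ((y : ℂ) - 1)‖ =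
      t ^ (x - 1) * (1 - t) ^ (y - 1) := by
    rw [norm_mul, ← Complex.ofReal_one, ← Complex.ofReal_sub 1 t,
      Complex.norm_cpow_eq_rpow_re_of_pos ht₀, Complex.norm_cpow_eq_rpow_re_of_pos hs]
    simp
  rw [hnorm, Real.norm_of_nonneg (by positivity)]
  exact mul_le_of_le_one_right (by positivity) hexp

theorem extBeta_eq_integral_Ioo (p q x y : ℝ) :
    extBeta p q x y =
      ∫ t in Ioo (0 : ℝ) 1, t ^ (x - 1) * (1 - t) ^ (y - 1) * Real.exp (-p / t - q / (1 - t)) := by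
  rw [extBeta, intervalIntegral.integral_of_le zero_le_one, integral_Ioc_eq_integral_Ioo]

/-- The geometric mean of two powers is the power with the averaged exponent. -/
theorem sqrt_rpow_mul_sqrt_rpow {t : ℝ} (ht : 0 < t) (a b : ℝ) :
    √(t ^ (a - 1)) * √(t ^ (b - 1)) = t ^ ((a + b) / 2 - 1) := by
  rw [Real.sqrt_eq_rpow, Real.sqrt_eq_rpow, ← Real.rpow_mul ht.le, ← Real.rpow_mul ht.le,
    ← Real.rpow_add ht]
  ring_nf

theorem extBeta_sq_midpoint_le (p q : ℝ) (hp : 0 < p) (hq : 0 < q)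
    (x₁ y₁ x₂ y₂ : ℝ) (hx₁ : 0 < x₁) (hy₁ : 0 < y₁) (hx₂ : 0 < x₂) (hy₂ : 0 < y₂) :
    extBeta p q ((x₁ + x₂) / 2) ((y₁ + y₂) / 2) ^ 2 ≤
      extBeta p q x₁ y₁ * extBeta p q x₂ y₂ := by
  have nonneg (x y : ℝ) : 0 ≤ᵐ[volume.restrict (Ioo (0 : ℝ) 1)]
      fun t : ℝ ↦ t ^ (x - 1) * (1 - t) ^ (y - 1) * Real.exp (-p / t - q / (1 - t)) := by
    filter_upwards [ae_restrict_mem measurableSet_Ioo] with t ⟨ht₀, ht₁⟩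
    have hs : 0 < 1 - t := sub_pos.2 ht₁
    simp only [Pi.zero_apply]
    positivity
  simp only [extBeta_eq_integral_Ioo]
  convert sq_integral_sqrt_mul_sqrt_le (integrableOn_extBeta_integrand hp.le hq.le hx₁ hy₁)
    (integrableOn_extBeta_integrand hp.le hq.le hx₂ hy₂) (nonneg x₁ y₁) (nonneg x₂ y₂) using 2
  refine setIntegral_congr_fun measurableSet_Ioo fun t ⟨ht₀, ht₁⟩ ↦ ?_
  have hs : 0 < 1 - t := sub_pos.2 ht₁
  rw [Real.sqrt_mul (by positivity), Real.sqrt_mul (by positivity), Real.sqrt_mul (by positivity),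
    Real.sqrt_mul (by positivity), mul_mul_mul_comm, mul_mul_mul_comm √(t ^ (x₁ - 1)),
    sqrt_rpow_mul_sqrt_rpow ht₀, sqrt_rpow_mul_sqrt_rpow hs, Real.mul_self_sqrt (by positivity)]
end

section
/- Let p, q > 0, let σ > 0, let γ, x > 0, and let β > 0 satisfy γ > β + 2σ. Then Φ_{p,q}(β + σ; γ; x)² ≥ (B(β + σ, γ)² / (B(β + 2σ, γ) · B(β, γ))) · Φ_{p,q}(β + 2σ; γ; x) · Φ_{p,q}(β; γ; x), where B(·,·) denotes the classical Euler beta function. -/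
/-- The classical Euler beta function `B(x,y) = ∫₀¹ t^(x-1) (1-t)^(y-1) dt`. -/
noncomputable def eulerBeta (x y : ℝ) : ℝ :=
  ∫ t in (0:ℝ)..1, t ^ (x - 1) * (1 - t) ^ (y - 1)

/-- The extended `(p,q)`-confluent hypergeometric function
`Φ_{p,q}(β;γ;x) = (1/B(β,γ-β)) ∫₀¹ t^(β-1) (1-t)^(γ-β-1) exp(x t - p/t - q/(1-t)) dt`. -/
noncomputable def extPhi (p q β γ x : ℝ) : ℝ :=
  (1 / eulerBeta β (γ - β)) *
    ∫ t in (0:ℝ)..1, t ^ (β - 1) * (1 - t) ^ (γ - β - 1) * Real.exp (x * t - p / t - q / (1 - t))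

open MeasureTheory Set

/-- The unnormalised beta density. -/
noncomputable def betaKernel (b c t : ℝ) : ℝ := t ^ (b - 1) * (1 - t) ^ (c - 1)

lemma integral_zero_one_eq_Ioo (f : ℝ → ℝ) :
    ∫ t in (0:ℝ)..1, f t = ∫ t in Ioo (0:ℝ) 1, f t := by
  rw [intervalIntegral.integral_of_le zero_le_one, integral_Ioc_eq_integral_Ioo]

lemma eulerBeta_eq (b c : ℝ) : eulerBeta b c = ∫ t in Ioo (0:ℝ) 1, betaKernel b c t :=
  integral_zero_one_eq_Ioo _

lemma betaKernel_pos (b c : ℝ) {t : ℝ} (ht : t ∈ Ioo (0:ℝ) 1) : 0 < betaKernel b c t :=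
  mul_pos (Real.rpow_pos_of_pos ht.1 _) (Real.rpow_pos_of_pos (sub_pos.2 ht.2) _)

lemma integrableOn_betaKernel {b c : ℝ} (hb : 0 < b) (hc : 0 < c) :
    IntegrableOn (betaKernel b c) (Ioo 0 1) := by
  have h := Complex.betaIntegral_convergent (u := b) (v := c) (by simpa) (by simpa)
  rw [intervalIntegrable_iff_integrableOn_Ioo_of_le zero_le_one] at h
  refine IntegrableOn.congr_fun h.re (fun t ht => ?_) measurableSet_Ioo
  have h1 : (0:ℝ) ≤ 1 - t := sub_nonneg.2 ht.2.le
  simp only [betaKernel]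
  norm_cast
  rw [← Complex.ofReal_cpow ht.1.le, ← Complex.ofReal_cpow h1, RCLike.re_to_complex,
    Complex.re_mul_ofReal, Complex.ofReal_re]

lemma integral_Ioo_pos {f : ℝ → ℝ} (hf : IntegrableOn f (Ioo 0 1))
    (hpos : ∀ t ∈ Ioo (0:ℝ) 1, 0 < f t) : 0 < ∫ t in Ioo (0:ℝ) 1, f t := by
  rw [← integral_zero_one_eq_Ioo]
  exact intervalIntegral.intervalIntegral_pos_of_pos_on
    ((intervalIntegrable_iff_integrableOn_Ioo_of_le zero_le_one).2 hf) hpos zero_lt_one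

lemma eulerBeta_pos {b c : ℝ} (hb : 0 < b) (hc : 0 < c) : 0 < eulerBeta b c := by
  rw [eulerBeta_eq]
  exact integral_Ioo_pos (integrableOn_betaKernel hb hc) fun t ht => betaKernel_pos b c ht

lemma integral_three_term {μ : Measure ℝ} {f g h : ℝ → ℝ} (hf : Integrable f μ)
    (hg : Integrable g μ) (hh : Integrable h μ) (a b c : ℝ) :
    ∫ t, (a * f t - b * g t - c * h t) ∂μ =
      a * ∫ t, f t ∂μ - b * ∫ t, g t ∂μ - c * ∫ t, h t ∂μ := by
  have hfg : Integrable (fun t => a * f t - b * g t) μ := (hf.const_mul a).sub (hg.const_mul b)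
  rw [integral_sub hfg (hh.const_mul c), integral_sub (hf.const_mul a) (hg.const_mul b),
    integral_const_mul, integral_const_mul, integral_const_mul]

/-- Cauchy–Schwarz: the beta function is midpoint log-convex in its first argument. -/
lemma eulerBeta_sq_le {b c σ : ℝ} (hb : 0 < b) (hc : 0 < c) (hσ : 0 < σ) :
    eulerBeta (b + σ) c ^ 2 ≤ eulerBeta (b + 2 * σ) c * eulerBeta b c := by
  have h0 := integrableOn_betaKernel hb hc
  have h1 := integrableOn_betaKernel (add_pos hb hσ) hc
  have h2 := integrableOn_betaKernel (b := b + 2 * σ) (by positivity) hc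
  have hB := eulerBeta_pos hb hc
  set r := eulerBeta (b + σ) c / eulerBeta b c with hr
  have key : 0 ≤ ∫ t in Ioo (0:ℝ) 1, (1 * betaKernel (b + 2 * σ) c t
      - 2 * r * betaKernel (b + σ) c t - -r ^ 2 * betaKernel b c t) := by
    refine setIntegral_nonneg measurableSet_Ioo fun t ht => ?_
    have e1 : betaKernel (b + σ) c t = betaKernel b c t * t ^ σ := by
      rw [betaKernel, betaKernel, add_sub_right_comm, Real.rpow_add ht.1]; ring
    have e2 : betaKernel (b + 2 * σ) c t = betaKernel b c t * t ^ σ * t ^ σ := by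
      rw [betaKernel, betaKernel, add_sub_right_comm, two_mul, Real.rpow_add ht.1,
        Real.rpow_add ht.1]; ring
    rw [e1, e2]
    have := mul_nonneg (betaKernel_pos b c ht).le (sq_nonneg (t ^ σ - r))
    linarith
  rw [integral_three_term h2 h1 h0, ← eulerBeta_eq, ← eulerBeta_eq, ← eulerBeta_eq] at key
  have e : eulerBeta (b + σ) c = r * eulerBeta b c := by rw [hr]; field_simp
  rw [e] at key ⊢
  nlinarith

/-- The beta integral in the coordinate `m t / (1 - t + m t)`. -/
lemma integral_betaKernel_mul_rpow (b c : ℝ) {m : ℝ} (hm : 0 < m) :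
    ∫ t in Ioo (0:ℝ) 1, betaKernel b c t * (1 - t + m * t) ^ (-(b + c)) =
      m ^ (-b) * eulerBeta b c := by
  have hden : ∀ t ∈ Ioo (0:ℝ) 1, 0 < 1 - t + m * t := fun t ht => by
    have := mul_pos hm ht.1
    linarith [ht.2]
  have himg : (fun t : ℝ => m * t / (1 - t + m * t)) '' Ioo 0 1 = Ioo 0 1 := by
    ext v
    constructor
    · rintro ⟨t, ht, rfl⟩
      have := hden t ht
      have := mul_pos hm ht.1
      exact ⟨by positivity, (div_lt_one (hden t ht)).2 (by linarith [ht.2])⟩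
    · intro hv
      have hd : 0 < m * (1 - v) + v := by
        have := mul_pos hm (sub_pos.2 hv.2)
        linarith [hv.1]
      refine ⟨v / (m * (1 - v) + v), ⟨div_pos hv.1 hd, (div_lt_one hd).2 ?_⟩, ?_⟩
      · have := mul_pos hm (sub_pos.2 hv.2)
        linarith
      · have : 1 - v / (m * (1 - v) + v) + m * (v / (m * (1 - v) + v))
            = m / (m * (1 - v) + v) := by
          field_simp; ring
        simp only [this]
        field_simp
  have hinj : InjOn (fun t : ℝ => m * t / (1 - t + m * t)) (Ioo 0 1) := by
    intro s hs t ht hst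
    simp only [div_eq_div_iff (hden s hs).ne' (hden t ht).ne'] at hst
    have : m * (s - t) = 0 := by linear_combination hst
    rcases mul_eq_zero.1 this with h | h
    · exact absurd h hm.ne'
    · linarith
  have hder : ∀ t ∈ Ioo (0:ℝ) 1, HasDerivWithinAt (fun t : ℝ => m * t / (1 - t + m * t))
      (m / (1 - t + m * t) ^ 2) (Ioo 0 1) t := by
    intro t ht
    have h1 : HasDerivAt (fun t : ℝ => m * t) m t := by
      simpa using (hasDerivAt_id t).const_mul m
    have h2 : HasDerivAt (fun t : ℝ => 1 - t + m * t) (-1 + m) t :=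
      ((hasDerivAt_id t).const_sub 1).add h1
    refine ((h1.div h2 (hden t ht).ne').congr_deriv ?_).hasDerivWithinAt
    ring
  have key := integral_image_eq_integral_abs_deriv_smul measurableSet_Ioo hder hinj
    (betaKernel b c)
  rw [himg, ← eulerBeta_eq] at key
  rw [key, ← integral_const_mul]
  refine setIntegral_congr_fun measurableSet_Ioo fun t ht => ?_
  have hd := hden t ht
  have e : 1 - m * t / (1 - t + m * t) = (1 - t) / (1 - t + m * t) := by
    field_simp; ring
  simp only [betaKernel, smul_eq_mul, e]
  generalize 1 - t + m * t = d at hd ⊢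
  rw [abs_of_pos (by positivity), Real.div_rpow (mul_pos hm ht.1).le hd.le,
    Real.div_rpow (sub_pos.2 ht.2).le hd.le, Real.mul_rpow hm.le ht.1.le,
    Real.rpow_neg hm.le, Real.rpow_neg hd.le, Real.rpow_add hd, Real.rpow_sub_one hm.ne',
    Real.rpow_sub_one hd.ne', Real.rpow_sub_one hd.ne']
  have := Real.rpow_pos_of_pos hm b
  have := Real.rpow_pos_of_pos hd b
  have := Real.rpow_pos_of_pos hd c
  field_simp

/-- A quadratic polynomial matching the sign pattern of the indicator of an interval. -/
lemma exists_quadratic_sign {s : ℝ → ℝ} {A S : Set ℝ} (hs : MonotoneOn s A)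
    (hs0 : ∀ t ∈ A, 0 < s t) (hSA : S ⊆ A) (hS : S.OrdConnected) :
    ∃ b₀ b₁ b₂ : ℝ, 0 < b₁ ∧ (∀ t ∈ S, 0 ≤ b₁ * s t - b₀ - b₂ * s t ^ 2) ∧
      ∀ t ∈ A, t ∉ S → b₁ * s t - b₀ - b₂ * s t ^ 2 ≤ 0 := by
  rcases S.eq_empty_or_nonempty with rfl | hne
  · refine ⟨1 / 2, 1, 1 / 2, one_pos, by simp, fun t _ _ => ?_⟩
    nlinarith [sq_nonneg (s t - 1)]
  have hneI : (s '' S).Nonempty := hne.image s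
  have hbelow : BddBelow (s '' S) := ⟨0, by rintro _ ⟨t, ht, rfl⟩; exact (hs0 t (hSA ht)).le⟩
  have hlow : ∀ t ∈ S, sInf (s '' S) ≤ s t := fun t ht => csInf_le hbelow ⟨t, ht, rfl⟩
  have hout : ∀ t ∈ A, t ∉ S → s t ≤ sInf (s '' S) ∨ ∀ v ∈ s '' S, v ≤ s t := by
    intro t htA htS
    by_cases h : ∃ u ∈ S, u ≤ t
    · obtain ⟨u, hu, hut⟩ := h
      right
      rintro _ ⟨v, hv, rfl⟩
      refine hs (hSA hv) htA (le_of_not_gt fun htv => htS (hS.out hu hv ⟨hut, htv.le⟩))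
    · push Not at h
      left
      refine le_csInf hneI ?_
      rintro _ ⟨v, hv, rfl⟩
      exact hs htA (hSA hv) (h v hv).le
  have hinf0 : 0 ≤ sInf (s '' S) :=
    le_csInf hneI (by rintro _ ⟨t, ht, rfl⟩; exact (hs0 t (hSA ht)).le)
  by_cases hab : BddAbove (s '' S)
  · have hup : ∀ t ∈ S, s t ≤ sSup (s '' S) := fun t ht => le_csSup hab ⟨t, ht, rfl⟩
    obtain ⟨u, hu⟩ := hne
    refine ⟨sInf (s '' S) * sSup (s '' S), sInf (s '' S) + sSup (s '' S), 1, ?_, ?_, ?_⟩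
    · linarith [hup u hu, hs0 u (hSA hu)]
    · intro t ht
      nlinarith [mul_nonneg (sub_nonneg.2 (hlow t ht)) (sub_nonneg.2 (hup t ht))]
    · intro t htA htS
      have hle : sInf (s '' S) ≤ sSup (s '' S) := (hlow u hu).trans (hup u hu)
      rcases hout t htA htS with h | h
      · nlinarith [mul_nonneg (sub_nonneg.2 h) (sub_nonneg.2 (h.trans hle))]
      · have h' : sSup (s '' S) ≤ s t := csSup_le hneI h
        nlinarith [mul_nonneg (sub_nonneg.2 h') (sub_nonneg.2 (hle.trans h'))]
  · refine ⟨sInf (s '' S), 1, 0, one_pos, fun t ht => by linarith [hlow t ht],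
      fun t htA htS => ?_⟩
    rcases hout t htA htS with h | h
    · linarith
    · exact absurd ⟨s t, h⟩ hab

/-- Borell's inequality for the beta kernel: normalised moments of a log-concave weight are
log-concave in the exponent. -/
theorem integral_betaKernel_mul_exp_logConcave {h : ℝ → ℝ} {M : ℝ}
    (hconc : ConcaveOn ℝ (Ioo 0 1) h) (hM : ∀ t ∈ Ioo (0:ℝ) 1, h t ≤ M)
    {β γ σ : ℝ} (hβ : 0 < β) (hσ : 0 < σ) (hγ : β + 2 * σ < γ) :
    ((∫ t in Ioo (0:ℝ) 1, betaKernel (β + 2 * σ) (γ - (β + 2 * σ)) t * Real.exp (h t)) /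
        eulerBeta (β + 2 * σ) (γ - (β + 2 * σ))) *
      ((∫ t in Ioo (0:ℝ) 1, betaKernel β (γ - β) t * Real.exp (h t)) / eulerBeta β (γ - β)) ≤
    ((∫ t in Ioo (0:ℝ) 1, betaKernel (β + σ) (γ - (β + σ)) t * Real.exp (h t)) /
        eulerBeta (β + σ) (γ - (β + σ))) ^ 2 := by
  have hcont : ContinuousOn h (Ioo 0 1) := hconc.continuousOn isOpen_Ioo
  have hint : ∀ b, 0 < b → b < γ →
      IntegrableOn (fun t => betaKernel b (γ - b) t * Real.exp (h t)) (Ioo 0 1) := by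
    intro b hb hbγ
    refine Integrable.mul_bdd (c := Real.exp M) (integrableOn_betaKernel hb (sub_pos.2 hbγ))
      ((hcont.rexp).aestronglyMeasurable measurableSet_Ioo) ?_
    refine ae_restrict_of_forall_mem measurableSet_Ioo fun t ht => ?_
    rw [Real.norm_of_nonneg (Real.exp_pos _).le]
    exact Real.exp_le_exp.2 (hM t ht)
  set Φ : ℝ → ℝ := fun b =>
    (∫ t in Ioo (0:ℝ) 1, betaKernel b (γ - b) t * Real.exp (h t)) / eulerBeta b (γ - b) with hΦ
  have hΦpos : ∀ b, 0 < b → b < γ → 0 < Φ b := fun b hb hbγ =>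
    div_pos (integral_Ioo_pos (hint b hb hbγ)
      fun t ht => mul_pos (betaKernel_pos _ _ ht) (Real.exp_pos _))
      (eulerBeta_pos hb (sub_pos.2 hbγ))
  change Φ (β + 2 * σ) * Φ β ≤ Φ (β + σ) ^ 2
  have hΦ0 := hΦpos β hβ (by linarith)
  have hΦ2 := hΦpos (β + 2 * σ) (by positivity) hγ
  obtain ⟨m, hm, hmΦ⟩ : ∃ m : ℝ, 0 < m ∧ m ^ (-(2 * σ)) = Φ (β + 2 * σ) / Φ β := by
    refine ⟨(Φ (β + 2 * σ) / Φ β) ^ (-(2 * σ))⁻¹, by positivity, ?_⟩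
    exact Real.rpow_inv_rpow (by positivity) (by linarith)
  set K := Φ β * m ^ β with hK
  have hKpos : 0 < K := by positivity
  have hden : ∀ t ∈ Ioo (0:ℝ) 1, 0 < 1 - t + m * t := fun t ht => by
    have := mul_pos hm ht.1
    linarith [ht.2]
  set w : ℝ → ℝ := fun t => K * (1 - t + m * t) ^ (-γ) with hw
  have hwint : ∀ b, 0 < b → b < γ →
      IntegrableOn (fun t => betaKernel b (γ - b) t * w t) (Ioo 0 1) := by
    intro b hb hbγ
    have hcw : ContinuousOn w (Icc 0 1) := by
      refine ContinuousOn.mul continuousOn_const (ContinuousOn.rpow_const (by fun_prop) ?_)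
      intro t ht
      left
      rcases ht.1.eq_or_lt with h0 | h0
      · simp [← h0]
      · have := mul_pos hm h0
        linarith [ht.2]
    obtain ⟨C, hC⟩ := isCompact_Icc.exists_bound_of_continuousOn hcw
    refine Integrable.mul_bdd (c := C) (integrableOn_betaKernel hb (sub_pos.2 hbγ))
      ((hcw.mono Ioo_subset_Icc_self).aestronglyMeasurable measurableSet_Ioo) ?_
    exact ae_restrict_of_forall_mem measurableSet_Ioo fun t ht => hC t (Ioo_subset_Icc_self ht)
  have hwval : ∀ b, ∫ t in Ioo (0:ℝ) 1, betaKernel b (γ - b) t * w t =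
      K * m ^ (-b) * eulerBeta b (γ - b) := by
    intro b
    have := integral_betaKernel_mul_rpow b (γ - b) hm
    rw [add_sub_cancel] at this
    rw [mul_assoc, ← this, ← integral_const_mul]
    refine setIntegral_congr_fun measurableSet_Ioo fun t _ => ?_
    simp only [hw]; ring
  have hΦint : ∀ b, 0 < b → b < γ →
      ∫ t in Ioo (0:ℝ) 1, betaKernel b (γ - b) t * Real.exp (h t) =
        Φ b * eulerBeta b (γ - b) := fun b hb hbγ =>
    (div_mul_cancel₀ _ (eulerBeta_pos hb (sub_pos.2 hbγ)).ne').symm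
  set D : ℝ → ℝ → ℝ := fun b t =>
    betaKernel b (γ - b) t * Real.exp (h t) - betaKernel b (γ - b) t * w t with hD
  have hDint : ∀ b, 0 < b → b < γ → IntegrableOn (D b) (Ioo 0 1) := fun b hb hbγ =>
    (hint b hb hbγ).sub (hwint b hb hbγ)
  have hDval : ∀ b, 0 < b → b < γ → ∫ t in Ioo (0:ℝ) 1, D b t =
      (Φ b - K * m ^ (-b)) * eulerBeta b (γ - b) := fun b hb hbγ => by
    rw [hD, integral_sub (hint b hb hbγ) (hwint b hb hbγ), hwval, hΦint b hb hbγ, sub_mul]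
  have hK0 : K * m ^ (-β) = Φ β := by
    rw [hK, mul_assoc, ← Real.rpow_add hm]; simp
  have hK2 : K * m ^ (-(β + 2 * σ)) = Φ (β + 2 * σ) := by
    rw [neg_add, Real.rpow_add hm, ← mul_assoc, hK0, hmΦ]; field_simp
  -- the weight exceeds the comparison weight on an interval
  set S : Set ℝ := {t ∈ Ioo (0:ℝ) 1 |
    0 < h t + γ * Real.log (1 - t + m * t) - Real.log K} with hS
  have hSord : S.OrdConnected := by
    have hlog : ConcaveOn ℝ (Ioo (0:ℝ) 1) fun t => Real.log (1 - t + m * t) := by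
      refine ⟨convex_Ioo _ _, fun x hx y hy a b ha hb hab => ?_⟩
      have := strictConcaveOn_log_Ioi.concaveOn.2 (hden x hx) (hden y hy) ha hb hab
      refine this.trans_eq (congrArg Real.log ?_)
      simp only [smul_eq_mul]
      linear_combination hab
    exact (((hconc.add (hlog.smul (by linarith : 0 ≤ γ))).sub
      (convexOn_const (Real.log K) (convex_Ioo 0 1))).convex_gt 0).ordConnected
  have hlogw : ∀ t ∈ Ioo (0:ℝ) 1, w t =
      Real.exp (Real.log K - γ * Real.log (1 - t + m * t)) := by
    intro t ht
    rw [sub_eq_add_neg, Real.exp_add, Real.exp_log hKpos]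
    simp only [hw]
    rw [Real.rpow_def_of_pos (hden t ht)]
    ring_nf
  obtain ⟨b₀, b₁, b₂, hb₁, hin, hout⟩ := exists_quadratic_sign (A := Ioo (0:ℝ) 1)
    (s := fun t => (t / (1 - t)) ^ σ) (S := S) (fun x hx y hy hxy =>
      Real.rpow_le_rpow (div_pos hx.1 (sub_pos.2 hx.2)).le
        (div_le_div₀ hy.1.le hxy (sub_pos.2 hy.2) (by linarith)) hσ.le)
    (fun t ht => Real.rpow_pos_of_pos (div_pos ht.1 (sub_pos.2 ht.2)) σ)
    (fun t ht => ht.1) hSord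
  have hkernel : ∀ b r, ∀ t ∈ Ioo (0:ℝ) 1, betaKernel (b + r) (γ - (b + r)) t =
      betaKernel b (γ - b) t * (t / (1 - t)) ^ r := by
    intro b r t ht
    have h1 : 0 < 1 - t := sub_pos.2 ht.2
    rw [betaKernel, betaKernel, Real.div_rpow ht.1.le h1.le, add_sub_right_comm,
      Real.rpow_add ht.1, show γ - (b + r) - 1 = γ - b - 1 - r by ring, Real.rpow_sub h1]
    ring
  have key : 0 ≤ ∫ t in Ioo (0:ℝ) 1, (b₁ * D (β + σ) t - b₀ * D β t - b₂ * D (β + 2 * σ) t) := by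
    refine setIntegral_nonneg measurableSet_Ioo fun t ht => ?_
    have hu : 0 < t / (1 - t) := div_pos ht.1 (sub_pos.2 ht.2)
    have e : b₁ * D (β + σ) t - b₀ * D β t - b₂ * D (β + 2 * σ) t =
        betaKernel β (γ - β) t * ((Real.exp (h t) - w t) *
          (b₁ * (t / (1 - t)) ^ σ - b₀ - b₂ * ((t / (1 - t)) ^ σ) ^ 2)) := by
      simp only [hD]
      rw [hkernel β σ t ht, hkernel β (2 * σ) t ht, two_mul, Real.rpow_add hu]
      ring
    rw [e]
    refine mul_nonneg (betaKernel_pos _ _ ht).le ?_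
    by_cases htS : t ∈ S
    · refine mul_nonneg ?_ (hin t htS)
      rw [hlogw t ht, sub_nonneg, Real.exp_le_exp]
      linarith [htS.2]
    · refine mul_nonneg_of_nonpos_of_nonpos ?_ (hout t ht htS)
      rw [hlogw t ht, sub_nonpos, Real.exp_le_exp]
      have : ¬ 0 < h t + γ * Real.log (1 - t + m * t) - Real.log K := fun h' => htS ⟨ht, h'⟩
      linarith
  have i0 := hDint β hβ (by linarith)
  have i1 := hDint (β + σ) (by positivity) (by linarith)
  have i2 := hDint (β + 2 * σ) (by positivity) hγ
  rw [integral_three_term i1 i0 i2, hDval β hβ (by linarith), hDval (β + σ) (by positivity) (by linarith),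
    hDval (β + 2 * σ) (by positivity) hγ, hK0, hK2, sub_self, sub_self, zero_mul, zero_mul,
    mul_zero, mul_zero, sub_zero, sub_zero] at key
  have hB := eulerBeta_pos (b := β + σ) (c := γ - (β + σ)) (by positivity) (by linarith)
  have hle : K * m ^ (-(β + σ)) ≤ Φ (β + σ) :=
    sub_nonneg.1 (nonneg_of_mul_nonneg_left (nonneg_of_mul_nonneg_right key hb₁) hB)
  calc Φ (β + 2 * σ) * Φ β = (K * m ^ (-(β + σ))) ^ 2 := by
        rw [← hK0, ← hK2, mul_pow, ← Real.rpow_natCast (m ^ _), ← Real.rpow_mul hm.le,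
          mul_mul_mul_comm, ← Real.rpow_add hm]
        push_cast
        ring_nf
    _ ≤ Φ (β + σ) ^ 2 := pow_le_pow_left₀ (by positivity) hle 2

lemma concaveOn_extPhi_exponent {p q : ℝ} (hp : 0 < p) (hq : 0 < q) (x : ℝ) :
    ConcaveOn ℝ (Ioo 0 1) fun t => x * t - p / t - q / (1 - t) := by
  have hinv : ConvexOn ℝ (Ioi 0) fun t : ℝ => t⁻¹ := by
    simpa using convexOn_zpow (𝕜 := ℝ) (-1)
  have h1 : ConvexOn ℝ (Ioo (0:ℝ) 1) fun t => p * t⁻¹ :=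
    (hinv.subset (fun t ht => ht.1) (convex_Ioo 0 1)).smul hp.le
  have h2 : ConvexOn ℝ (Ioo (0:ℝ) 1) fun t => q * (1 - t)⁻¹ := by
    refine ConvexOn.smul hq.le ⟨convex_Ioo _ _, fun u hu v hv a b ha hb hab => ?_⟩
    have := hinv.2 (sub_pos.2 hu.2 : 0 < 1 - u) (sub_pos.2 hv.2 : 0 < 1 - v) ha hb hab
    refine Eq.trans_le (congrArg (·⁻¹) ?_) this
    simp only [smul_eq_mul]
    linear_combination -hab
  have h0 : ConcaveOn ℝ (Ioo (0:ℝ) 1) fun t => x * t :=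
    (LinearMap.mulLeft ℝ x).concaveOn (convex_Ioo 0 1)
  simp only [div_eq_mul_inv]
  exact (h0.sub h1).sub h2

lemma extPhi_eq (p q β γ x : ℝ) :
    extPhi p q β γ x = (∫ t in Ioo (0:ℝ) 1,
      betaKernel β (γ - β) t * Real.exp (x * t - p / t - q / (1 - t))) / eulerBeta β (γ - β) := by
  rw [extPhi, integral_zero_one_eq_Ioo, one_div_mul_eq_div]
  rfl

theorem extPhi_turan (p q σ γ x β : ℝ) (hp : 0 < p) (hq : 0 < q)
    (hσ : 0 < σ) (hγ : 0 < γ) (hx : 0 < x) (hβ : 0 < β) (hγβ : β + 2 * σ < γ) :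
    (eulerBeta (β + σ) γ ^ 2 / (eulerBeta (β + 2 * σ) γ * eulerBeta β γ)) *
        extPhi p q (β + 2 * σ) γ x * extPhi p q β γ x ≤
      extPhi p q (β + σ) γ x ^ 2 := by
  have hnonneg : ∀ b, 0 < b → b < γ → 0 ≤ extPhi p q b γ x := fun b hb hbγ => by
    rw [extPhi_eq]
    exact div_nonneg (setIntegral_nonneg measurableSet_Ioo fun t ht =>
      mul_nonneg (betaKernel_pos _ _ ht).le (Real.exp_pos _).le)
      (eulerBeta_pos hb (sub_pos.2 hbγ)).le
  have hratio : eulerBeta (β + σ) γ ^ 2 / (eulerBeta (β + 2 * σ) γ * eulerBeta β γ) ≤ 1 :=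
    (div_le_one (mul_pos (eulerBeta_pos (by positivity) hγ) (eulerBeta_pos hβ hγ))).2
      (eulerBeta_sq_le hβ hγ hσ)
  have hbound : ∀ t ∈ Ioo (0:ℝ) 1, x * t - p / t - q / (1 - t) ≤ x := fun t ht => by
    have h1 : 0 < p / t := div_pos hp ht.1
    have h2 : 0 < q / (1 - t) := div_pos hq (sub_pos.2 ht.2)
    nlinarith [ht.2]
  rw [mul_assoc]
  refine (mul_le_of_le_one_left (mul_nonneg (hnonneg _ (by positivity) hγβ)
    (hnonneg β hβ (by linarith))) hratio).trans ?_
  rw [extPhi_eq, extPhi_eq, extPhi_eq]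
  exact integral_betaKernel_mul_exp_logConcave (concaveOn_extPhi_exponent hp hq x) hbound hβ hσ hγβ
end
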